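/- arXiv:1204.0289 — 2 statements merged into one kernel-verified Lean document; each statement's English description precedes it below -/
import Mathlib

section
/- For any probability measures μ on ℝ and any a ∈ ℝ, the subordination distribution satisfies: (i) σ ⊳ μ = B[Φ[μ]], where σ is the standard semicircular distribution; (ii) μ ⊳ δ₀ = μ; (iii) μ ⊳ μ = B[μ]; (iv) δ_a ⊳ μ = δ_a. -/
open MeasureTheory Complex

noncomputable section

/-- The Cauchy transform `G_μ(z) = ∫ 1/(z - x) dμ(x)` of a measure on `ℝ`. -/
def cauchyG (μ : Measure ℝ) (z : ℂ) : ℂ := ∫ x : ℝ, (z - (x : ℂ))⁻¹ ∂μ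

/-- The F-transform `F_μ = 1/G_μ`. -/
def Ftr (μ : Measure ℝ) (z : ℂ) : ℂ := (cauchyG μ z)⁻¹

/-- The open upper half-plane `ℂ⁺`. -/
def UHP : Set ℂ := {z : ℂ | 0 < z.im}

/-- The truncated cone `Γ_{α,M} = {z ∈ ℂ⁺ : |Re z| < α · Im z, Im z > M}`. -/
def tcone (α M : ℝ) : Set ℂ := {z : ℂ | |z.re| < α * z.im ∧ M < z.im}

/-- `φ` is a Voiculescu transform of `μ`: `φ(F_μ(z)) + F_μ(z) = z` on some truncated cone. -/
def IsVT (μ : Measure ℝ) (φ : ℂ → ℂ) : Prop :=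
  ∃ α M : ℝ, 0 < α ∧ 0 < M ∧ ∀ z ∈ tcone α M, φ (Ftr μ z) + Ftr μ z = z

/-- `ψ` is a two-state Voiculescu transform of the pair `(μt, μ)`:
`ψ(F_μ(z)) + F_{μt}(z) = z` on some truncated cone. -/
def IsTwoStateVT (μt μ : Measure ℝ) (ψ : ℂ → ℂ) : Prop :=
  ∃ α M : ℝ, 0 < α ∧ 0 < M ∧ ∀ z ∈ tcone α M, ψ (Ftr μ z) + Ftr μt z = z

/-- `μ` is freely infinitely divisible: some Voiculescu transform `φ` of `μ` is such that
`t·φ` is a Voiculescu transform of a probability measure for every `t ≥ 0`. -/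
def IsFID (μ : Measure ℝ) : Prop :=
  ∃ φ : ℂ → ℂ, IsVT μ φ ∧ ∀ t : ℝ, 0 ≤ t →
    ∃ ν : Measure ℝ, IsProbabilityMeasure ν ∧ IsVT ν (fun z => (t : ℂ) * φ z)

/-- The semicircular distribution with mean `β` and variance `γ` (Dirac mass at `β` for `γ = 0`). -/
def semicircle (β γ : ℝ) : Measure ℝ :=
  if γ = 0 then Measure.dirac β
  else volume.withDensity
    (fun x => ENNReal.ofReal ((2 * Real.pi * γ)⁻¹ * Real.sqrt (4 * γ - (x - β) ^ 2)))

open Filter Topology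

lemma sub_ofReal_ne_zero {z : ℂ} (hz : z.im ≠ 0) (x : ℝ) : z - (x : ℂ) ≠ 0 := by
  intro h
  apply hz
  simpa using congrArg Complex.im h

lemma norm_resolvent_le {z : ℂ} (hz : 0 < z.im) (x : ℝ) : ‖(z - (x : ℂ))⁻¹‖ ≤ z.im⁻¹ := by
  rw [norm_inv]
  refine inv_anti₀ hz ?_
  simpa using (le_abs_self _).trans (Complex.abs_im_le_norm (z - (x : ℂ)))

lemma continuous_resolvent {z : ℂ} (hz : z.im ≠ 0) :
    Continuous fun x : ℝ => (z - (x : ℂ))⁻¹ :=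
  (by fun_prop : Continuous fun x : ℝ => z - (x : ℂ)).inv₀ (sub_ofReal_ne_zero hz)

lemma integrable_resolvent (μ : Measure ℝ) [IsFiniteMeasure μ] {z : ℂ} (hz : 0 < z.im) :
    Integrable (fun x : ℝ => (z - (x : ℂ))⁻¹) μ :=
  Integrable.of_bound (continuous_resolvent hz.ne').aestronglyMeasurable z.im⁻¹
    (.of_forall (norm_resolvent_le hz))

lemma neg_im_resolvent (z : ℂ) (x : ℝ) :
    -((z - (x : ℂ))⁻¹).im = z.im / ((z.re - x) ^ 2 + z.im ^ 2) := by
  simp [Complex.inv_im, Complex.normSq_apply, neg_div, sq]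

lemma neg_im_cauchyG (μ : Measure ℝ) [IsFiniteMeasure μ] {z : ℂ} (hz : 0 < z.im) :
    -(cauchyG μ z).im = ∫ x : ℝ, z.im / ((z.re - x) ^ 2 + z.im ^ 2) ∂μ := by
  have h := Complex.imCLM.integral_comp_comm (integrable_resolvent μ hz)
  simp only [Complex.imCLM_apply] at h
  rw [cauchyG, ← h, ← integral_neg]
  exact integral_congr_ae (.of_forall fun x => neg_im_resolvent z x)

lemma integral_poisson_eq_arctan {y : ℝ} (hy : 0 < y) (t c d : ℝ) :
    ∫ x in c..d, y / ((x - t) ^ 2 + y ^ 2) =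
      Real.arctan ((d - t) / y) - Real.arctan ((c - t) / y) := by
  refine intervalIntegral.integral_eq_sub_of_hasDerivAt
    (f := fun x => Real.arctan ((x - t) / y)) (fun x _ => ?_) ?_
  · have h := (((hasDerivAt_id x).sub_const t).div_const y).arctan
    refine h.congr_deriv ?_
    have : (x - t) ^ 2 + y ^ 2 ≠ 0 := by positivity
    simp only [id]
    field_simp
    ring
  · refine (Continuous.div (by fun_prop) (by fun_prop) fun x => ?_).intervalIntegrable _ _
    positivity

lemma integral_neg_im_cauchyG (μ : Measure ℝ) [IsFiniteMeasure μ] {y : ℝ} (hy : 0 < y) (c d : ℝ) :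
    ∫ x in c..d, -(cauchyG μ ⟨x, y⟩).im =
      ∫ t, (Real.arctan ((d - t) / y) - Real.arctan ((c - t) / y)) ∂μ := by
  have h1 : ∀ x : ℝ, -(cauchyG μ ⟨x, y⟩).im = ∫ t : ℝ, y / ((x - t) ^ 2 + y ^ 2) ∂μ :=
    fun x => neg_im_cauchyG μ (z := ⟨x, y⟩) hy
  simp_rw [h1, ← integral_poisson_eq_arctan hy]
  refine intervalIntegral_integral_swap ?_
  have : IsFiniteMeasure (volume.restrict (Set.uIoc c d)) := ⟨by simp [Set.uIoc]⟩
  refine Integrable.of_bound (C := y⁻¹) (Continuous.aestronglyMeasurable ?_) (.of_forall ?_)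
  · refine Continuous.div (by fun_prop) (by fun_prop) fun x => ?_
    positivity
  · rintro ⟨x, t⟩
    simp only [Function.uncurry_apply_pair]
    rw [Real.norm_of_nonneg (by positivity), div_le_iff₀ (by positivity)]
    have : y⁻¹ * y ^ 2 = y := by field_simp
    nlinarith [mul_nonneg (inv_nonneg.2 hy.le) (sq_nonneg (x - t))]

lemma tendsto_arctan_step (b t : ℝ) :
    Tendsto (fun N : ℝ => Real.arctan ((b + N⁻¹ - t) / (N ^ 2)⁻¹)) atTop
      (𝓝 (Real.pi / 2 - (Set.Ioi b).indicator (fun _ => Real.pi) t)) := by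
  have key : (fun N : ℝ => N * ((b - t) * N + 1)) =ᶠ[atTop]
      fun N : ℝ => (b + N⁻¹ - t) / (N ^ 2)⁻¹ := by
    filter_upwards [eventually_gt_atTop 0] with N hN
    field_simp
    ring
  by_cases h : b < t
  · rw [Set.indicator_of_mem (by exact h)]
    have hlim : Tendsto (fun N : ℝ => N * ((b - t) * N + 1)) atTop atBot :=
      tendsto_id.atTop_mul_atBot₀
        (tendsto_atBot_add_const_right _ _ (tendsto_id.const_mul_atTop_of_neg (sub_neg.2 h)))
    have := (tendsto_nhds_of_tendsto_nhdsWithin Real.tendsto_arctan_atBot).comp (hlim.congr' key)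
    rwa [show Real.pi / 2 - Real.pi = -(Real.pi / 2) by ring]
  · rw [Set.indicator_of_notMem (by exact h), sub_zero]
    have hlim : Tendsto (fun N : ℝ => N * ((b - t) * N + 1)) atTop atTop := by
      refine tendsto_atTop_mono' _ ?_ tendsto_id
      filter_upwards [eventually_gt_atTop 0] with N hN
      have : 0 ≤ (b - t) * N := mul_nonneg (by linarith [not_lt.1 h]) hN.le
      simp only [id]
      nlinarith
    exact (tendsto_nhds_of_tendsto_nhdsWithin Real.tendsto_arctan_atTop).comp (hlim.congr' key)

/-- Stieltjes inversion. -/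
lemma tendsto_integral_neg_im_cauchyG (μ : Measure ℝ) [IsFiniteMeasure μ] {a b : ℝ} (hab : a < b) :
    Tendsto (fun N : ℝ => ∫ x in (a + N⁻¹)..(b + N⁻¹), -(cauchyG μ ⟨x, (N ^ 2)⁻¹⟩).im) atTop
      (𝓝 (Real.pi * μ.real (Set.Ioc a b))) := by
  have hlim : Real.pi * μ.real (Set.Ioc a b) =
      ∫ t, (Set.Ioc a b).indicator (fun _ => Real.pi) t ∂μ := by
    rw [integral_indicator_const _ measurableSet_Ioc, smul_eq_mul, mul_comm]
  rw [hlim]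
  have hcongr : (fun N : ℝ => ∫ t, (Real.arctan ((b + N⁻¹ - t) / (N ^ 2)⁻¹) -
      Real.arctan ((a + N⁻¹ - t) / (N ^ 2)⁻¹)) ∂μ) =ᶠ[atTop]
      fun N : ℝ => ∫ x in (a + N⁻¹)..(b + N⁻¹), -(cauchyG μ ⟨x, (N ^ 2)⁻¹⟩).im := by
    filter_upwards [eventually_gt_atTop 0] with N hN
    exact (integral_neg_im_cauchyG μ (by positivity) _ _).symm
  refine Tendsto.congr' hcongr ?_
  refine tendsto_integral_filter_of_dominated_convergence (fun _ => Real.pi)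
    (.of_forall fun N => Continuous.aestronglyMeasurable ?_) (.of_forall fun N => .of_forall
      fun t => ?_) (integrable_const _) (.of_forall fun t => ?_)
  · exact (Real.continuous_arctan.comp (by fun_prop)).sub (Real.continuous_arctan.comp (by fun_prop))
  · rw [Real.norm_eq_abs, abs_le]
    constructor <;> linarith [Real.neg_pi_div_two_lt_arctan ((b + N⁻¹ - t) / (N ^ 2)⁻¹),
      Real.arctan_lt_pi_div_two ((b + N⁻¹ - t) / (N ^ 2)⁻¹),
      Real.neg_pi_div_two_lt_arctan ((a + N⁻¹ - t) / (N ^ 2)⁻¹),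
      Real.arctan_lt_pi_div_two ((a + N⁻¹ - t) / (N ^ 2)⁻¹)]
  · convert (tendsto_arctan_step b t).sub (tendsto_arctan_step a t) using 2
    by_cases h1 : a < t <;> by_cases h2 : t ≤ b
    · simp [Set.indicator, h1, h2, not_lt.2 h2]
    · simp [Set.indicator, h1, h2, not_le.1 h2]
    · simp [Set.indicator, h1, not_lt.2 h2]
    · exact absurd (hab.trans (not_le.1 h2)) h1

lemma eq_of_cauchyG_eq {μ ν : Measure ℝ} [IsProbabilityMeasure μ] [IsProbabilityMeasure ν]
    (h : ∀ z ∈ UHP, cauchyG μ z = cauchyG ν z) : μ = ν := by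
  refine Measure.ext_of_Ioc μ ν fun a b hab => ?_
  have hcongr : (fun N : ℝ => ∫ x in (a + N⁻¹)..(b + N⁻¹), -(cauchyG μ ⟨x, (N ^ 2)⁻¹⟩).im)
      =ᶠ[atTop] fun N : ℝ => ∫ x in (a + N⁻¹)..(b + N⁻¹), -(cauchyG ν ⟨x, (N ^ 2)⁻¹⟩).im := by
    filter_upwards [eventually_gt_atTop 0] with N hN
    refine intervalIntegral.integral_congr fun x _ => ?_
    have hz : (⟨x, (N ^ 2)⁻¹⟩ : ℂ) ∈ UHP := by
      change 0 < (N ^ 2)⁻¹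
      positivity
    simp only [h _ hz]
  have := tendsto_nhds_unique ((tendsto_integral_neg_im_cauchyG μ hab).congr' hcongr)
    (tendsto_integral_neg_im_cauchyG ν hab)
  rwa [mul_right_inj' Real.pi_ne_zero, measureReal_eq_measureReal_iff] at this

lemma eq_dirac_of_Ftr_eq {μ : Measure ℝ} [IsProbabilityMeasure μ] {a y : ℝ} (hy : 0 < y)
    (h : Ftr μ ⟨a, y⟩ = ⟨a, y⟩ - (a : ℂ)) : μ = Measure.dirac a := by
  have hz : (⟨a, y⟩ : ℂ) - (a : ℂ) = y * I := by
    apply Complex.ext <;> simp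
  have hG : cauchyG μ ⟨a, y⟩ = (y * I)⁻¹ := by rw [← hz, ← h, Ftr, inv_inv]
  have h1 := neg_im_cauchyG μ (z := ⟨a, y⟩) hy
  rw [hG] at h1
  have h2 : -((y * I : ℂ)⁻¹).im = y⁻¹ := by simp
  rw [h2] at h1
  have hb : ∀ x : ℝ, y / ((a - x) ^ 2 + y ^ 2) ≤ y⁻¹ := fun x => by
    rw [div_le_iff₀ (by positivity)]
    have : y⁻¹ * y ^ 2 = y := by field_simp
    nlinarith [mul_nonneg (inv_nonneg.2 hy.le) (sq_nonneg (a - x))]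
  have hint : Integrable (fun x : ℝ => y / ((a - x) ^ 2 + y ^ 2)) μ := by
    refine Integrable.of_bound (C := y⁻¹) (Continuous.aestronglyMeasurable ?_) (.of_forall ?_)
    · refine Continuous.div (by fun_prop) (by fun_prop) fun x => ?_
      positivity
    · intro x
      rw [Real.norm_of_nonneg (by positivity)]
      exact hb x
  have h0 : ∫ x, (y⁻¹ - y / ((a - x) ^ 2 + y ^ 2)) ∂μ = 0 := by
    rw [integral_sub (integrable_const _) hint, ← h1]
    simp
  rw [integral_eq_zero_iff_of_nonneg (fun x => sub_nonneg.2 (hb x))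
    ((integrable_const _).sub hint)] at h0
  have hae : (id : ℝ → ℝ) =ᵐ[μ] fun _ => a := by
    filter_upwards [h0] with x hx
    have hx' : y⁻¹ - y / ((a - x) ^ 2 + y ^ 2) = 0 := hx
    have : (a - x) ^ 2 + y ^ 2 ≠ 0 := by positivity
    field_simp at hx'
    have : (a - x) ^ 2 = 0 := by linarith
    simp only [id]
    linarith [pow_eq_zero_iff (two_ne_zero) |>.1 this]
  simpa [Measure.map_const] using Measure.map_congr hae

/-- `P` holds throughout some truncated cone. -/
def ConeEventually (P : ℂ → Prop) : Prop :=
  ∃ α M : ℝ, 0 < α ∧ 0 < M ∧ ∀ z ∈ tcone α M, P z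

lemma im_pos_of_mem_tcone {α M : ℝ} (hM : 0 < M) {z : ℂ} (hz : z ∈ tcone α M) : 0 < z.im :=
  hM.trans hz.2

lemma ConeEventually.im_pos : ConeEventually fun z => 0 < z.im :=
  ⟨1, 1, one_pos, one_pos, fun _ => im_pos_of_mem_tcone one_pos⟩

lemma tcone_subset_tcone {α β M N : ℝ} (hN : 0 < N) (hαβ : β ≤ α) (hMN : M ≤ N) :
    tcone β N ⊆ tcone α M := fun _ hz =>
  ⟨hz.1.trans_le (mul_le_mul_of_nonneg_right hαβ (im_pos_of_mem_tcone hN hz).le),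
    hMN.trans_lt hz.2⟩

lemma ConeEventually.and {P Q : ℂ → Prop} (hP : ConeEventually P) (hQ : ConeEventually Q) :
    ConeEventually fun z => P z ∧ Q z := by
  obtain ⟨α, M, hα, hM, hP⟩ := hP
  obtain ⟨β, N, hβ, hN, hQ⟩ := hQ
  have hMN : 0 < max M N := hM.trans_le (le_max_left _ _)
  exact ⟨min α β, max M N, lt_min hα hβ, hMN, fun z hz =>
    ⟨hP z (tcone_subset_tcone hMN (min_le_left _ _) (le_max_left _ _) hz),
      hQ z (tcone_subset_tcone hMN (min_le_right _ _) (le_max_right _ _) hz)⟩⟩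

lemma ConeEventually.mono {P Q : ℂ → Prop} (hP : ConeEventually P) (h : ∀ z, P z → Q z) :
    ConeEventually Q := by
  obtain ⟨α, M, hα, hM, hP⟩ := hP
  exact ⟨α, M, hα, hM, fun z hz => h z (hP z hz)⟩

lemma norm_le_of_mem_tcone {α M : ℝ} (hM : 0 < M) {z : ℂ} (hz : z ∈ tcone α M) :
    ‖z‖ ≤ (1 + α) * z.im := by
  have := Complex.norm_le_abs_re_add_abs_im z
  rw [abs_of_pos (im_pos_of_mem_tcone hM hz)] at this
  linarith [hz.1]

lemma mem_tcone_of_norm_sub_le {α M : ℝ} (hα : 0 < α) (hM : 0 < M) {z u : ℂ}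
    (hz : z ∈ tcone (α / 2) (2 * M)) (hu : ‖u - z‖ ≤ α / (4 * (1 + α)) * z.im) :
    u ∈ tcone α M := by
  have hy := im_pos_of_mem_tcone (by positivity) hz
  have hδ : α / (4 * (1 + α)) * (1 + α) = α / 4 := by field_simp
  have hδ0 : 0 < α / (4 * (1 + α)) := by positivity
  set δ := α / (4 * (1 + α))
  have hδ1 : δ ≤ 1 / 4 := by nlinarith
  have hre := (Complex.abs_re_le_norm (u - z)).trans hu
  have him := (Complex.abs_im_le_norm (u - z)).trans hu
  rw [Complex.sub_re] at hre
  rw [Complex.sub_im, abs_le] at him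
  obtain ⟨hz1, hz2⟩ := hz
  have h1 : |u.re| ≤ |z.re| + δ * z.im := by
    have := abs_add_le z.re (u.re - z.re)
    rw [add_sub_cancel] at this
    linarith
  constructor
  · have h2 : α * (z.im - δ * z.im) ≤ α * u.im := by
      gcongr
      linarith
    have h3 : δ * (1 + α) * z.im = α / 4 * z.im := by rw [hδ]
    nlinarith [mul_pos hα hy]
  · nlinarith

lemma norm_ofReal_mul_resolvent_le {α M : ℝ} (hM : 0 < M) {z : ℂ} (hz : z ∈ tcone α M) (x : ℝ) :
    ‖(x : ℂ) * (z - (x : ℂ))⁻¹‖ ≤ min (|x| / M) (2 + α) := by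
  have hy := im_pos_of_mem_tcone hM hz
  have hne := sub_ofReal_ne_zero hy.ne' x
  have him : z.im ≤ ‖z - (x : ℂ)‖ := by
    simpa using (le_abs_self _).trans (Complex.abs_im_le_norm (z - (x : ℂ)))
  have hα : 0 ≤ 1 + α := by
    have := (norm_nonneg z).trans (norm_le_of_mem_tcone hM hz)
    exact nonneg_of_mul_nonneg_left this hy
  rw [norm_mul, norm_inv, Complex.norm_real, Real.norm_eq_abs, ← div_eq_mul_inv]
  refine le_min ?_ ?_
  · gcongr
    exact hz.2.le.trans him
  · rw [div_le_iff₀ (norm_pos_iff.2 hne)]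
    have h1 : |x| ≤ ‖z‖ + ‖z - (x : ℂ)‖ := by
      have := norm_sub_le z (z - (x : ℂ))
      rwa [sub_sub_cancel, Complex.norm_real] at this
    nlinarith [norm_le_of_mem_tcone hM hz, mul_le_mul_of_nonneg_left him hα]

lemma exists_norm_mul_cauchyG_sub_one_le (μ : Measure ℝ) [IsProbabilityMeasure μ] {α ε : ℝ}
    (hα : 0 < α) (hε : 0 < ε) :
    ∃ M₀ : ℝ, ∀ M, M₀ ≤ M → 0 < M → ∀ z ∈ tcone α M, ‖z * cauchyG μ z - 1‖ ≤ ε := by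
  have hint : ∀ M : ℝ, 0 < M → Integrable (fun x : ℝ => min (|x| / M) (2 + α)) μ := fun M hM =>
    Integrable.of_bound (C := 2 + α) (by fun_prop : Continuous _).aestronglyMeasurable
      (.of_forall fun x => by
        rw [Real.norm_of_nonneg (by positivity)]
        exact min_le_right _ _)
  have hlim : Tendsto (fun M : ℝ => ∫ x, min (|x| / M) (2 + α) ∂μ) atTop (𝓝 (∫ _, 0 ∂μ)) := by
    refine tendsto_integral_filter_of_dominated_convergence (fun _ => 2 + α)
      (.of_forall fun M => (by fun_prop : Continuous _).aestronglyMeasurable) ?_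
      (integrable_const _) (.of_forall fun x => ?_)
    · filter_upwards [eventually_gt_atTop 0] with M hM
      refine .of_forall fun x => ?_
      rw [Real.norm_of_nonneg (by positivity)]
      exact min_le_right _ _
    · have := (tendsto_const_nhds (x := |x|)).div_atTop tendsto_id |>.min
        (tendsto_const_nhds (x := 2 + α))
      rwa [min_eq_left (by positivity)] at this
  rw [integral_zero] at hlim
  obtain ⟨M₀, hM₀⟩ := eventually_atTop.1 (hlim.eventually_le_const hε)
  refine ⟨M₀, fun M hMM hM z hz => le_trans ?_ (hM₀ M hMM)⟩
  have hy := im_pos_of_mem_tcone hM hz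
  have heq : z * cauchyG μ z - 1 = ∫ x : ℝ, (x : ℂ) * (z - (x : ℂ))⁻¹ ∂μ := by
    have h1 : (1 : ℂ) = ∫ _ : ℝ, (1 : ℂ) ∂μ := by simp
    rw [cauchyG, ← integral_const_mul, h1, ← integral_sub
      ((integrable_resolvent μ hy).const_mul z) (integrable_const _)]
    refine integral_congr_ae (.of_forall fun x => ?_)
    have := sub_ofReal_ne_zero hy.ne' x
    simp only
    field_simp
    ring
  rw [heq]
  exact norm_integral_le_of_norm_le (hint M hM) (.of_forall (norm_ofReal_mul_resolvent_le hM hz))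

lemma norm_inv_sub_le {z g : ℂ} {ε : ℝ} (hε : ε ≤ 1 / 2) (h : ‖z * g - 1‖ ≤ ε) :
    ‖g⁻¹ - z‖ ≤ 2 * ε * ‖z‖ := by
  have hzg : 1 / 2 ≤ ‖z * g‖ := by
    have := norm_sub_norm_le (1 : ℂ) (z * g)
    rw [norm_one, norm_sub_rev] at this
    linarith
  have hne : z * g ≠ 0 := norm_pos_iff.1 (by linarith)
  have hz := left_ne_zero_of_mul hne
  have hg := right_ne_zero_of_mul hne
  have heq : g⁻¹ - z = -(z * ((z * g - 1) / (z * g))) := by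
    field_simp
    ring
  rw [heq, norm_neg, norm_mul, norm_div, mul_comm]
  gcongr
  rw [div_le_iff₀ (by linarith)]
  nlinarith [norm_nonneg (z * g - 1)]

lemma ConeEventually.Ftr_mem (μ : Measure ℝ) [IsProbabilityMeasure μ] {P : ℂ → Prop}
    (hP : ConeEventually P) : ConeEventually fun z => P (Ftr μ z) := by
  obtain ⟨α, M, hα, hM, hP⟩ := hP
  set δ := α / (4 * (1 + α)) with hδ
  have hδ0 : 0 < δ := by positivity
  have hδ1 : δ ≤ 1 / 4 := by
    rw [hδ, div_le_iff₀ (by positivity)]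
    linarith
  have hε : δ / (2 * (1 + α)) ≤ 1 / 2 := by
    rw [div_le_iff₀ (by positivity)]
    linarith
  obtain ⟨M₀, hM₀⟩ := exists_norm_mul_cauchyG_sub_one_le μ (half_pos hα)
    (ε := δ / (2 * (1 + α))) (by positivity)
  have hN : 0 < max M₀ (2 * M) := (by positivity : 0 < 2 * M).trans_le (le_max_right _ _)
  refine ⟨α / 2, max M₀ (2 * M), half_pos hα, hN, fun z hz => hP _ ?_⟩
  refine mem_tcone_of_norm_sub_le hα hM
    (tcone_subset_tcone hN le_rfl (le_max_right _ _) hz) ?_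
  have hy := im_pos_of_mem_tcone hN hz
  calc ‖Ftr μ z - z‖ ≤ 2 * (δ / (2 * (1 + α))) * ‖z‖ :=
        norm_inv_sub_le hε (hM₀ _ (le_max_left _ _) hN z hz)
    _ ≤ 2 * (δ / (2 * (1 + α))) * ((1 + α) * z.im) := by
        gcongr
        refine (norm_le_of_mem_tcone hN hz).trans ?_
        gcongr
        linarith
    _ = δ * z.im := by field_simp

lemma integral_inv_one_sub_mul_exp {q : ℂ} (hq : ‖q‖ < 1) :
    ∫ θ in (0 : ℝ)..2 * Real.pi, (1 - q * exp (θ * I))⁻¹ = 2 * Real.pi := by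
  have hne : ∀ z ∈ Metric.closedBall (0 : ℂ) 1, 1 - q * z ≠ 0 := fun z hz h => by
    have h1 : ‖q * z‖ = 1 := by rw [← sub_eq_zero.1 h, norm_one]
    rw [norm_mul] at h1
    have := mem_closedBall_zero_iff.1 hz
    nlinarith [norm_nonneg q, norm_nonneg z]
  have hd : DiffContOnCl ℂ (fun z => (1 - q * z)⁻¹) (Metric.ball 0 |1|) := by
    rw [abs_one]
    refine DifferentiableOn.diffContOnCl fun z hz => ?_
    rw [closure_ball _ one_ne_zero] at hz
    exact (by fun_prop : DifferentiableAt ℂ (fun z => 1 - q * z) z).inv (hne z hz)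
      |>.differentiableWithinAt
  have h := hd.circleAverage
  rw [Real.circleAverage_def] at h
  simp only [circleMap_zero, ofReal_one, one_mul, mul_zero, sub_zero, inv_one] at h
  rw [inv_smul_eq_iff₀ (by positivity)] at h
  simpa using h

lemma integral_inv_sub_two_cos {q : ℂ} (hq : ‖q‖ < 1) (hq0 : q ≠ 0) :
    ∫ θ in (0 : ℝ)..Real.pi, (q⁻¹ + q - 2 * Real.cos θ)⁻¹ = Real.pi / (q⁻¹ - q) := by
  have hne : ∀ s : ℂ, ‖s‖ ≤ 1 → 1 - q * s ≠ 0 := fun s hs h => by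
    have h1 : ‖q * s‖ = 1 := by rw [← sub_eq_zero.1 h, norm_one]
    rw [norm_mul] at h1
    nlinarith [norm_nonneg q, norm_nonneg s]
  have hq2 : 1 - q ^ 2 ≠ 0 := by
    rw [sq]
    exact hne q hq.le
  have hexp : ∀ θ : ℝ, 1 - q * exp (θ * I) ≠ 0 := fun θ =>
    hne _ (norm_exp_ofReal_mul_I θ).le
  have hcont : Continuous fun θ : ℝ => (1 - q * exp (θ * I))⁻¹ :=
    (by fun_prop : Continuous fun θ : ℝ => 1 - q * exp (θ * I)).inv₀ hexp
  have hconj : ∀ θ : ℝ, exp (((2 * Real.pi - θ : ℝ) : ℂ) * I) = (exp (θ * I))⁻¹ := fun θ => by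
    rw [← Complex.exp_neg]
    push_cast
    rw [sub_mul, sub_eq_neg_add, Complex.exp_add, Complex.exp_two_pi_mul_I, mul_one]
  have hkey : ∀ θ : ℝ, (q⁻¹ + q - 2 * Real.cos θ)⁻¹ =
      (q⁻¹ - q)⁻¹ * ((1 - q * exp (θ * I))⁻¹ +
        (1 - q * exp (((2 * Real.pi - θ : ℝ) : ℂ) * I))⁻¹ - 1) := fun θ => by
    have h1 := hexp θ
    have h2 := hexp (2 * Real.pi - θ)
    rw [hconj] at h2 ⊢
    have he : exp (θ * I) ≠ 0 := exp_ne_zero _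
    have hcos : 2 * (Real.cos θ : ℂ) = exp (θ * I) + (exp (θ * I))⁻¹ := by
      rw [ofReal_cos, Complex.two_cos, neg_mul, Complex.exp_neg]
    rw [hcos]
    generalize exp (θ * I) = e at *
    have hD : q⁻¹ + q - (e + e⁻¹) = q⁻¹ * ((1 - q * e) * (1 - q * e⁻¹)) := by
      field_simp
      ring
    have hW : q⁻¹ - q = q⁻¹ * (1 - q ^ 2) := by
      field_simp
    rw [hD, hW]
    have h2' : e - q ≠ 0 := fun h => h2 (by rw [← sub_eq_zero.1 h, mul_inv_cancel₀ he, sub_self])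
    have h3 : 1 - q * e⁻¹ = (e - q) / e := by field_simp
    rw [h3]
    field_simp
    ring
  have hsym : ∫ θ in (0 : ℝ)..Real.pi, (1 - q * exp (((2 * Real.pi - θ : ℝ) : ℂ) * I))⁻¹ =
      ∫ θ in Real.pi..2 * Real.pi, (1 - q * exp (θ * I))⁻¹ := by
    rw [intervalIntegral.integral_comp_sub_left (fun θ : ℝ => (1 - q * exp (θ * I))⁻¹)]
    congr 1 <;> ring
  have hcont' : Continuous fun θ : ℝ => (1 - q * exp (((2 * Real.pi - θ : ℝ) : ℂ) * I))⁻¹ :=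
    hcont.comp (by fun_prop : Continuous fun θ : ℝ => 2 * Real.pi - θ)
  simp_rw [hkey]
  have hadd : Continuous fun θ : ℝ => (1 - q * exp (θ * I))⁻¹ +
      (1 - q * exp (((2 * Real.pi - θ : ℝ) : ℂ) * I))⁻¹ := hcont.add hcont'
  rw [intervalIntegral.integral_const_mul, intervalIntegral.integral_sub
      (hadd.intervalIntegrable _ _) (by simp),
    intervalIntegral.integral_add (hcont.intervalIntegrable _ _) (hcont'.intervalIntegrable _ _),
    hsym, intervalIntegral.integral_add_adjacent_intervals (hcont.intervalIntegrable _ _)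
      (hcont.intervalIntegrable _ _), integral_inv_one_sub_mul_exp hq]
  rw [intervalIntegral.integral_const, real_smul, div_eq_inv_mul]
  push_cast
  ring

lemma cauchyG_semicircle_eq (z : ℂ) (hz : z.im ≠ 0) : cauchyG (semicircle 0 1) z =
    (2 * Real.pi : ℂ)⁻¹ * ∫ θ in (0 : ℝ)..Real.pi,
      4 * (Real.sin θ : ℂ) ^ 2 * (z - 2 * Real.cos θ)⁻¹ := by
  have hsupp : Function.support (fun x : ℝ => ((2 * Real.pi * 1)⁻¹ *
      Real.sqrt (4 * 1 - (x - 0) ^ 2)) • (z - (x : ℂ))⁻¹) ⊆ Set.Ioc (-2) 2 := by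
    intro x hx
    by_contra h
    refine hx ?_
    have : (4 * 1 - (x - 0) ^ 2 : ℝ) ≤ 0 := by
      by_contra! h'
      exact h ⟨by nlinarith, by nlinarith⟩
    simp only [Real.sqrt_eq_zero_of_nonpos this, mul_zero, zero_smul]
  have hcont : Continuous fun x : ℝ => ((2 * Real.pi * 1)⁻¹ *
      Real.sqrt (4 * 1 - (x - 0) ^ 2)) • (z - (x : ℂ))⁻¹ :=
    (by fun_prop : Continuous fun x : ℝ => (2 * Real.pi * 1)⁻¹ *
      Real.sqrt (4 * 1 - (x - 0) ^ 2)).smul (continuous_resolvent hz)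
  rw [cauchyG, semicircle, if_neg one_ne_zero, integral_withDensity_eq_integral_toReal_smul
    (by fun_prop) (.of_forall fun _ => ENNReal.ofReal_lt_top)]
  have h1 : ∀ x : ℝ, (ENNReal.ofReal ((2 * Real.pi * 1)⁻¹ *
      Real.sqrt (4 * 1 - (x - 0) ^ 2))).toReal = (2 * Real.pi * 1)⁻¹ *
      Real.sqrt (4 * 1 - (x - 0) ^ 2) := fun x => ENNReal.toReal_ofReal (by positivity)
  simp_rw [h1]
  rw [← intervalIntegral.integral_eq_integral_of_support_subset hsupp]
  have hsub := intervalIntegral.integral_deriv_smul_comp (a := Real.pi) (b := 0)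
    (f := fun θ => 2 * Real.cos θ) (f' := fun θ => -(2 * Real.sin θ))
    (g := fun x : ℝ => ((2 * Real.pi * 1)⁻¹ *
      Real.sqrt (4 * 1 - (x - 0) ^ 2)) • (z - (x : ℂ))⁻¹)
    (fun θ _ => by simpa using (Real.hasDerivAt_cos θ).const_mul 2) (by fun_prop) hcont
  simp only [Real.cos_pi, Real.cos_zero, mul_neg, mul_one] at hsub
  simp only [mul_one]
  rw [← hsub, intervalIntegral.integral_symm, ← intervalIntegral.integral_neg,
    ← intervalIntegral.integral_const_mul]
  refine intervalIntegral.integral_congr fun θ hθ => ?_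
  rw [Set.uIcc_of_le Real.pi_pos.le] at hθ
  have hsin := Real.sin_nonneg_of_mem_Icc hθ
  have hsqrt : Real.sqrt (4 - (2 * Real.cos θ - 0) ^ 2) = 2 * Real.sin θ := by
    rw [show 4 - (2 * Real.cos θ - 0) ^ 2 = (2 * Real.sin θ) ^ 2 by
      nlinarith [Real.sin_sq_add_cos_sq θ], Real.sqrt_sq (by positivity)]
  simp only [Function.comp_apply, hsqrt, real_smul]
  push_cast
  ring

lemma cauchyG_semicircle {w : ℂ} (hw : 1 < ‖w‖) (hw' : 0 < w.im) :
    cauchyG (semicircle 0 1) (w + w⁻¹) = w⁻¹ := by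
  have hw0 : w ≠ 0 := norm_pos_iff.1 (one_pos.trans hw)
  have hn : 1 < Complex.normSq w := by
    rw [Complex.normSq_eq_norm_sq]
    nlinarith
  have him : (w + w⁻¹).im ≠ 0 := by
    rw [Complex.add_im, Complex.inv_im]
    refine ne_of_gt ?_
    have : w.im / Complex.normSq w < w.im := div_lt_self hw' hn
    rw [neg_div]
    linarith
  have hne : ∀ θ : ℝ, w + w⁻¹ - 2 * Real.cos θ ≠ 0 := fun θ => by
    simpa using sub_ofReal_ne_zero him (2 * Real.cos θ)
  have hww : w - w⁻¹ ≠ 0 := fun h => by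
    have h1 : ‖w‖ = ‖w‖⁻¹ := by rw [← norm_inv, ← sub_eq_zero.1 h]
    have := inv_lt_one_of_one_lt₀ hw
    linarith
  have hcont : Continuous fun θ : ℝ => (w + w⁻¹ - 2 * Real.cos θ)⁻¹ :=
    (by fun_prop : Continuous fun θ : ℝ => w + w⁻¹ - 2 * (Real.cos θ : ℂ)).inv₀ hne
  have hkey : ∀ θ : ℝ, 4 * (Real.sin θ : ℂ) ^ 2 * (w + w⁻¹ - 2 * Real.cos θ)⁻¹ =
      (w + w⁻¹ + (2 * Real.cos θ : ℝ)) - (w - w⁻¹) ^ 2 * (w + w⁻¹ - 2 * Real.cos θ)⁻¹ := fun θ => by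
    have hs : (Real.sin θ : ℂ) ^ 2 = 1 - (Real.cos θ : ℂ) ^ 2 := by
      have := Real.sin_sq θ
      exact_mod_cast this
    have hsq : (w - w⁻¹) ^ 2 = (w + w⁻¹) ^ 2 - 4 := by
      field_simp
      ring
    have h := mul_inv_cancel₀ (hne θ)
    rw [hs, hsq, ofReal_mul, ofReal_ofNat]
    linear_combination (w + w⁻¹ + 2 * (Real.cos θ : ℂ)) * h
  have hcos : ∫ θ in (0 : ℝ)..Real.pi, ((2 * Real.cos θ : ℝ) : ℂ) = 0 := by
    rw [intervalIntegral.integral_ofReal]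
    simp
  have hpoisson := integral_inv_sub_two_cos (q := w⁻¹)
    (by rw [norm_inv]; exact inv_lt_one_of_one_lt₀ hw) (inv_ne_zero hw0)
  rw [inv_inv] at hpoisson
  have hcc : Continuous fun θ : ℝ => ((2 * Real.cos θ : ℝ) : ℂ) := by fun_prop
  rw [cauchyG_semicircle_eq _ him]
  simp_rw [hkey]
  have hcc' : Continuous fun θ : ℝ => w + w⁻¹ + ((2 * Real.cos θ : ℝ) : ℂ) :=
    continuous_const.add hcc
  rw [intervalIntegral.integral_sub (hcc'.intervalIntegrable _ _)
      ((hcont.const_mul _).intervalIntegrable _ _),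
    intervalIntegral.integral_add (by simp) (hcc.intervalIntegrable _ _), hcos,
    intervalIntegral.integral_const_mul, hpoisson]
  have hpi : (Real.pi : ℂ) ≠ 0 := ofReal_ne_zero.2 Real.pi_ne_zero
  simp only [intervalIntegral.integral_const, sub_zero, real_smul, add_zero]
  rw [sq, mul_assoc, mul_div_cancel₀ _ hww]
  field_simp
  ring

lemma ConeEventually.voiculescu_semicircle {φ : ℂ → ℂ} (hφ : IsVT (semicircle 0 1) φ) :
    ConeEventually fun w => φ w = w⁻¹ := by
  obtain ⟨α, M, hα, hM, h⟩ := hφ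
  set δ := α / (4 * (1 + α)) with hδ
  have hδ0 : 0 < δ := by positivity
  have hN : 0 < max (2 * M) (max 1 δ⁻¹) := (by positivity : 0 < 2 * M).trans_le (le_max_left _ _)
  refine ⟨α / 2, max (2 * M) (max 1 δ⁻¹), half_pos hα, hN, fun w hw => ?_⟩
  have hy : 1 < w.im := ((le_max_left _ _).trans (le_max_right _ _)).trans_lt hw.2
  have hyδ : δ⁻¹ < w.im := ((le_max_right _ _).trans (le_max_right _ _)).trans_lt hw.2
  have hnorm : 1 < ‖w‖ := hy.trans_le ((le_abs_self _).trans (Complex.abs_im_le_norm w))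
  have hF : Ftr (semicircle 0 1) (w + w⁻¹) = w := by
    rw [Ftr, cauchyG_semicircle hnorm (by linarith), inv_inv]
  have hmem : w + w⁻¹ ∈ tcone α M := by
    refine mem_tcone_of_norm_sub_le hα hM
      (tcone_subset_tcone hN le_rfl (le_max_left _ _) hw) ?_
    rw [add_sub_cancel_left, norm_inv]
    calc ‖w‖⁻¹ ≤ 1 := (inv_lt_one_of_one_lt₀ hnorm).le
      _ = δ * δ⁻¹ := (mul_inv_cancel₀ hδ0.ne').symm
      _ ≤ δ * w.im := by gcongr
  have := h _ hmem
  rw [hF, add_comm] at this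
  exact add_left_cancel this

lemma ConeEventually.voiculescu_comp_subordination {μ c s : Measure ℝ} [IsProbabilityMeasure s]
    {φμ φc : ℂ → ℂ} (hφμ : IsVT μ φμ) (hφc : IsVT c φc)
    (hs : ∀ z ∈ UHP, cauchyG c z = cauchyG μ (Ftr s z)) :
    ConeEventually fun z => 0 < z.im ∧ 0 < (Ftr s z).im ∧ Ftr μ (Ftr s z) = Ftr c z ∧
      φμ (Ftr c z) + Ftr c z = Ftr s z ∧ φc (Ftr c z) + Ftr c z = z := by
  refine (((ConeEventually.im_pos.and (ConeEventually.im_pos.Ftr_mem s)).and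
    (ConeEventually.Ftr_mem s hφμ)).and hφc).mono ?_
  rintro z ⟨⟨⟨hz, hsz⟩, hμz⟩, hcz⟩
  have hF : Ftr μ (Ftr s z) = Ftr c z := by rw [Ftr, Ftr.eq_def c, hs z hz]
  rw [hF] at hμz
  exact ⟨hz, hsz, hF, hμz, hcz⟩

/-- Basic properties of subordination distributions:
(i) `σ ⊳ μ = B[Φ[μ]]`; (ii) `μ ⊳ δ₀ = μ`; (iii) `μ ⊳ μ = B[μ]`; (iv) `δ_a ⊳ μ = δ_a`.
Here `c1 = σ ⊞ μ`, `s1 = σ ⊳ μ`; `s2 = μ ⊳ δ₀` (note `G_{μ⊞δ₀} = G_μ`, `G_{δ₀}(w) = w⁻¹`);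
`c3 = μ ⊞ μ`, `s3 = μ ⊳ μ`; `c4 = δ_a ⊞ μ`, `s4 = δ_a ⊳ μ`; and `pm = Φ[μ]`
(`F_{Φ[μ]}(z) = z − G_μ(z)`); `B[ν]` has Voiculescu transform `z ↦ z − F_ν(z)`. -/
theorem stmt12
    (μ : Measure ℝ) (hμ : IsProbabilityMeasure μ) (a : ℝ)
    (φμ φσ : ℂ → ℂ) (hφμ : IsVT μ φμ) (hφσ : IsVT (semicircle 0 1) φσ)
    -- (i) σ ⊳ μ
    (c1 : Measure ℝ) (hc1prob : IsProbabilityMeasure c1)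
    (hc1 : IsVT c1 (fun z => φσ z + φμ z))
    (s1 : Measure ℝ) (hs1prob : IsProbabilityMeasure s1)
    (hs1 : ∀ z ∈ UHP, cauchyG c1 z = cauchyG μ (Ftr s1 z))
    (pm : Measure ℝ) (hpmprob : IsProbabilityMeasure pm)
    (hpm : ∀ z ∈ UHP, Ftr pm z = z - cauchyG μ z)
    -- (ii) μ ⊳ δ₀
    (s2 : Measure ℝ) (hs2prob : IsProbabilityMeasure s2)
    (hs2 : ∀ z ∈ UHP, cauchyG μ z = (Ftr s2 z)⁻¹)
    -- (iii) μ ⊳ μ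
    (c3 : Measure ℝ) (hc3prob : IsProbabilityMeasure c3)
    (hc3 : IsVT c3 (fun z => 2 * φμ z))
    (s3 : Measure ℝ) (hs3prob : IsProbabilityMeasure s3)
    (hs3 : ∀ z ∈ UHP, cauchyG c3 z = cauchyG μ (Ftr s3 z))
    -- (iv) δ_a ⊳ μ
    (c4 : Measure ℝ) (hc4prob : IsProbabilityMeasure c4)
    (hc4 : IsVT c4 (fun z => (a : ℂ) + φμ z))
    (s4 : Measure ℝ) (hs4prob : IsProbabilityMeasure s4)
    (hs4 : ∀ z ∈ UHP, cauchyG c4 z = cauchyG μ (Ftr s4 z)) :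
    IsVT s1 (fun z => z - Ftr pm z) ∧
    s2 = μ ∧
    IsVT s3 (fun z => z - Ftr μ z) ∧
    s4 = Measure.dirac a := by
  refine ⟨?_, (eq_of_cauchyG_eq fun z hz => ?_), ?_, ?_⟩
  · refine ((ConeEventually.voiculescu_comp_subordination hφμ hc1 hs1).and
      ((ConeEventually.voiculescu_semicircle hφσ).Ftr_mem c1)).mono ?_
    rintro z ⟨⟨hz, hsz, -, hμz, hcz⟩, hσz⟩
    simp only at hcz ⊢
    have hinv : (Ftr c1 z)⁻¹ = cauchyG μ (Ftr s1 z) := by rw [Ftr, inv_inv, hs1 z hz]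
    rw [hσz] at hcz
    rw [hpm _ hsz, ← hinv]
    linear_combination hcz - hμz
  · rw [hs2 z hz, Ftr, inv_inv]
  · refine (ConeEventually.voiculescu_comp_subordination hφμ hc3 hs3).mono ?_
    rintro z ⟨-, -, hF, hμz, hcz⟩
    simp only [hF]
    linear_combination hcz - 2 * hμz
  · obtain ⟨α, M, hα, hM, h⟩ := ConeEventually.voiculescu_comp_subordination hφμ hc4 hs4
    have hy : 0 < M + |a| / α + 1 := by positivity
    obtain ⟨-, -, -, hμz, hcz⟩ := h ⟨a, M + |a| / α + 1⟩ <| by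
      refine ⟨?_, ?_⟩
      · calc |a| = α * (|a| / α) := by field_simp
          _ < α * (M + |a| / α + 1) := by
            gcongr
            linarith
      · have : 0 ≤ |a| / α := by positivity
        simp only
        linarith
    refine eq_dirac_of_Ftr_eq hy ?_
    linear_combination hcz - hμz
end
end

section
/- Let ~β ∈ ℝ^d, ~γ > 0, ~ρ ∈ D_alg(d), and let {μ_t : t ≥ 0} ⊂ D_alg(d) be a free convolution semigroup (R^{μ_t} = t·R^{μ_1}). Define the two-state free convolution semigroup {(~μ_t, μ_t)} by R^{~μ_t, μ_t}(z) = t ~β·z + t ~γ Σ_{i=1}^d z_i (1 + M^{~ρ}(z)) z_i, and define τ ∈ D_alg(d) as the unique functional with μ_1 = τ ⊳ ~ρ. Then for every t ≥ 0, ~μ_t = δ_{t~β} ⊎ Φ[~ρ ⊞ τ^{⊞t}]^{⊎~γt}; explicitly, η^{~μ_t}(z) = t ~β·z + t ~γ Σ_{i=1}^d z_i (1 + M^{~ρ ⊞ τ^{⊞t}}(z)) z_i. -/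
open scoped BigOperators

noncomputable section

/-- Formal noncommutative power series in `d` indeterminates: coefficient functions on words.
A unital linear functional `μ` on `ℂ⟨x₁,…,x_d⟩` is identified with the coefficient function
`w ↦ μ[x_w]` of the series `1 + M^μ`; being unital means the coefficient of the empty word
is `1`. -/
abbrev NCS (d : ℕ) := List (Fin d) → ℂ

/-- The constant series `1`. -/
def oneS (d : ℕ) : NCS d := fun w => if w = [] then 1 else 0

/-- Product of noncommutative formal power series: convolution over splittings of words. -/
def mulS {d : ℕ} (f g : NCS d) : NCS d :=
  fun w => ∑ j ∈ Finset.range (w.length + 1), f (List.take j w) * g (List.drop j w)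

/-- The substitution `R(z₁·A, …, z_d·A)`: each monomial `z_{u(1)} ⋯ z_{u(k)}` of `R`
is replaced by `z_{u(1)} A z_{u(2)} A ⋯ z_{u(k)} A`. -/
def substS {d : ℕ} (R A : NCS d) : List (Fin d) → ℂ
  | [] => R []
  | i :: w => ∑ j ∈ Finset.range (w.length + 1),
      A (List.take j w) * substS (fun u => R (i :: u)) A (List.drop j w)
  termination_by w => w.length
  decreasing_by
    simp only [List.length_drop, List.length_cons]
    omega

/-- `R` is the `R`-transform of the functional with moment series `m = 1 + M`:
`R(z₁(1+M),…,z_d(1+M)) = M`, i.e. `substS R m = m - 1`. -/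
def HasR {d : ℕ} (m R : NCS d) : Prop :=
  R [] = 0 ∧ ∀ w, substS R m w = m w - oneS d w

/-- `m3` is the moment series of the free convolution of the functionals with moment series
`m1, m2`: `R`-transforms add. -/
def IsFreeConvS {d : ℕ} (m1 m2 m3 : NCS d) : Prop :=
  ∃ R1 R2 : NCS d, HasR m1 R1 ∧ HasR m2 R2 ∧ HasR m3 (fun w => R1 w + R2 w)

/-- `ms` is the moment series of the subordination distribution `μ1 ⊳ μ2`:
`R^{μ1⊳μ2}(z) = R^{μ1}(z₁(1+M^{μ2}),…)·(1+M^{μ2})⁻¹`, i.e.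
`R^{μ1⊳μ2}·(1+M^{μ2}) = R^{μ1}(z(1+M^{μ2}))`. -/
def IsSubordS {d : ℕ} (m1 m2 ms : NCS d) : Prop :=
  ∃ R1 Rs : NCS d, HasR m1 R1 ∧ HasR ms Rs ∧ ∀ w, mulS Rs m2 w = substS R1 m2 w

/-- The series `β·z + γ·Σᵢ zᵢ(1+M)zᵢ`, where `m = 1 + M`:  the coefficient of `z_i` is `β i`,
and the coefficient of a word `i v i` (same first and last letter) is `γ · m v`. -/
def genS {d : ℕ} (β : Fin d → ℂ) (γ : ℂ) (m : NCS d) : List (Fin d) → ℂ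
  | [] => 0
  | [i] => β i
  | i :: rest => if rest.getLast? = some i then γ * m rest.dropLast else 0

/-- The series of all words following a given first letter. -/
def tailS {d : ℕ} (f : NCS d) (i : Fin d) : NCS d := fun u => f (i :: u)

/-- The series consisting of the single indeterminate `z_i`. -/
def letterS {d : ℕ} (i : Fin d) : NCS d := fun w => if w = [i] then 1 else 0

section Product

variable {d : ℕ}

lemma tailS_add (f g : NCS d) (i : Fin d) : tailS (f + g) i = tailS f i + tailS g i := rfl

lemma tailS_smul (a : ℂ) (f : NCS d) (i : Fin d) : tailS (a • f) i = a • tailS f i := rfl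

lemma tailS_oneS (i : Fin d) : tailS (oneS d) i = 0 := by
  funext w; simp [tailS, oneS]

lemma mulS_nil (f g : NCS d) : mulS f g [] = f [] * g [] := by
  simp [mulS]

lemma mulS_cons (f g : NCS d) (i : Fin d) (w : List (Fin d)) :
    mulS f g (i :: w) = f [] * g (i :: w) + mulS (tailS f i) g w := by
  simp only [mulS, List.length_cons]
  rw [Finset.sum_range_succ']
  simp [tailS, add_comm]

lemma mulS_congr_right {f g g' : NCS d} {w : List (Fin d)}
    (h : ∀ u : List (Fin d), u.length ≤ w.length → g u = g' u) :
    mulS f g w = mulS f g' w := by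
  refine Finset.sum_congr rfl fun j _ => ?_
  rw [h _ (by simp)]

lemma mulS_add (f g h : NCS d) : mulS f (g + h) = mulS f g + mulS f h := by
  funext w; simp [mulS, mul_add, Finset.sum_add_distrib]

lemma add_mulS (f g h : NCS d) : mulS (f + g) h = mulS f h + mulS g h := by
  funext w; simp [mulS, add_mul, Finset.sum_add_distrib]

lemma mulS_smul (a : ℂ) (f g : NCS d) : mulS f (a • g) = a • mulS f g := by
  funext w; simp [mulS, Finset.mul_sum, mul_left_comm]

lemma smul_mulS (a : ℂ) (f g : NCS d) : mulS (a • f) g = a • mulS f g := by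
  funext w; simp [mulS, Finset.mul_sum, mul_assoc]

lemma zero_mulS (f : NCS d) : mulS 0 f = 0 := by
  funext w; simp [mulS]

lemma mulS_zero (f : NCS d) : mulS f 0 = 0 := by
  funext w; simp [mulS]

lemma oneS_mulS (f : NCS d) : mulS (oneS d) f = f := by
  funext w
  cases w with
  | nil => simp [mulS_nil, oneS]
  | cons i w => simp [mulS_cons, tailS_oneS, zero_mulS, oneS]

lemma mulS_oneS (f : NCS d) : mulS f (oneS d) = f := by
  funext w
  induction w generalizing f with
  | nil => simp [mulS_nil, oneS]
  | cons i w ih => rw [mulS_cons, ih]; simp [oneS, tailS]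

lemma tailS_mulS (f g : NCS d) (i : Fin d) :
    tailS (mulS f g) i = f [] • tailS g i + mulS (tailS f i) g := by
  funext w; simp [tailS, mulS_cons]

lemma mulS_assoc (f g h : NCS d) : mulS (mulS f g) h = mulS f (mulS g h) := by
  funext w
  induction w generalizing f with
  | nil => simp [mulS_nil, mul_assoc]
  | cons i w ih =>
    rw [mulS_cons, tailS_mulS, add_mulS, smul_mulS, Pi.add_apply, ih, mulS_cons, mulS_cons,
      mulS_nil]
    simp only [Pi.smul_apply, smul_eq_mul]
    ring

/-- The right inverse of a series with constant coefficient `1`. -/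
def invS (f : NCS d) : List (Fin d) → ℂ
  | [] => 1
  | i :: w => -∑ j ∈ Finset.range (w.length + 1),
      f (i :: List.take j w) * invS f (List.drop j w)
  termination_by w => w.length
  decreasing_by
    simp only [List.length_drop, List.length_cons]
    omega

lemma mulS_invS {f : NCS d} (hf : f [] = 1) : mulS f (invS f) = oneS d := by
  funext w
  cases w with
  | nil => simp [mulS_nil, hf, invS, oneS]
  | cons i w => rw [mulS_cons, invS, hf]; simp [mulS, tailS, oneS]

lemma invS_mulS {f : NCS d} (hf : f [] = 1) : mulS (invS f) f = oneS d := by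
  have hinv : mulS (invS f) (invS (invS f)) = oneS d := mulS_invS (by rw [invS])
  have h : invS (invS f) = f := by
    rw [← oneS_mulS (invS (invS f)), ← mulS_invS hf, mulS_assoc, hinv, mulS_oneS]
  rwa [h] at hinv

lemma mulS_left_cancel {f g h : NCS d} (hf : f [] = 1) (hgh : mulS f g = mulS f h) : g = h := by
  rw [← oneS_mulS g, ← invS_mulS hf, mulS_assoc, hgh, ← mulS_assoc, invS_mulS hf, oneS_mulS]

lemma mulS_right_cancel {f g h : NCS d} (hf : f [] = 1) (hgh : mulS g f = mulS h f) : g = h := by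
  rw [← mulS_oneS g, ← mulS_invS hf, ← mulS_assoc, hgh, mulS_assoc, mulS_invS hf, mulS_oneS]

lemma mulS_letterS (f : NCS d) (i : Fin d) (w : List (Fin d)) :
    mulS f (letterS i) w = if w.getLast? = some i then f w.dropLast else 0 := by
  induction w generalizing f with
  | nil => simp [mulS_nil, letterS]
  | cons j w ih =>
    rw [mulS_cons, ih]
    cases w with
    | nil => simp [letterS]
    | cons k w => simp [letterS, tailS]

end Product

section Substitution

variable {d : ℕ}

lemma substS_nil (R A : NCS d) : substS R A [] = R [] := by rw [substS]

lemma substS_cons (R A : NCS d) (i : Fin d) (w : List (Fin d)) :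
    substS R A (i :: w) = mulS A (substS (tailS R i) A) w := by
  rw [substS]; rfl

lemma tailS_substS (R A : NCS d) (i : Fin d) :
    tailS (substS R A) i = mulS A (substS (tailS R i) A) := by
  funext w; exact substS_cons R A i w

lemma substS_add (R R' A : NCS d) : substS (R + R') A = substS R A + substS R' A := by
  funext w
  induction hn : w.length using Nat.strong_induction_on generalizing w R R' with
  | _ n ih =>
    subst hn
    cases w with
    | nil => simp [substS_nil]
    | cons i w =>
      rw [Pi.add_apply, substS_cons, substS_cons, substS_cons, tailS_add,
        ← Pi.add_apply (mulS _ _), ← mulS_add]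
      exact mulS_congr_right fun u hu => ih _ (by simp; omega) _ _ u rfl

lemma substS_smul (a : ℂ) (R A : NCS d) : substS (a • R) A = a • substS R A := by
  funext w
  induction hn : w.length using Nat.strong_induction_on generalizing w R with
  | _ n ih =>
    subst hn
    cases w with
    | nil => simp [substS_nil]
    | cons i w =>
      rw [Pi.smul_apply, substS_cons, substS_cons, tailS_smul, ← Pi.smul_apply a (mulS _ _),
        ← mulS_smul]
      exact mulS_congr_right fun u hu => ih _ (by simp; omega) _ u rfl

lemma substS_zero (A : NCS d) : substS 0 A = 0 := by
  simpa using substS_smul 0 0 A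

lemma substS_oneS (A : NCS d) : substS (oneS d) A = oneS d := by
  funext w
  cases w with
  | nil => rw [substS_nil]
  | cons i w => rw [substS_cons, tailS_oneS, substS_zero, mulS_zero]; simp [oneS]

lemma tailS_letterS (i j : Fin d) :
    tailS (letterS i) j = (if j = i then (1 : ℂ) else 0) • oneS d := by
  funext w; by_cases h : j = i <;> simp [tailS, letterS, oneS, h]

lemma substS_letterS (i : Fin d) (A : NCS d) : substS (letterS i) A = mulS (letterS i) A := by
  funext w
  cases w with
  | nil => simp [substS_nil, mulS_nil, letterS]
  | cons j w =>
    rw [substS_cons, mulS_cons, tailS_letterS, substS_smul, substS_oneS, mulS_smul, smul_mulS,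
      mulS_oneS, oneS_mulS]
    simp [letterS]

lemma substS_mulS (f g A : NCS d) :
    substS (mulS f g) A = mulS (substS f A) (substS g A) := by
  funext w
  induction hn : w.length using Nat.strong_induction_on generalizing w f g with
  | _ n ih =>
    subst hn
    cases w with
    | nil => simp [substS_nil, mulS_nil]
    | cons i w =>
      rw [substS_cons, tailS_mulS, substS_add, substS_smul, mulS_add, mulS_smul, mulS_cons,
        tailS_substS, mulS_assoc, substS_nil, substS_cons, Pi.add_apply, Pi.smul_apply,
        smul_eq_mul]
      congr 1
      exact mulS_congr_right fun u hu => ih _ (by simp; omega) _ _ u rfl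

/-- Composition of substitutions: `R(zA)` evaluated at `zB` is `R(z · B · A(zB))`. -/
lemma substS_substS (R A B : NCS d) :
    substS (substS R A) B = substS R (mulS B (substS A B)) := by
  funext w
  induction hn : w.length using Nat.strong_induction_on generalizing w R with
  | _ n ih =>
    subst hn
    cases w with
    | nil => simp [substS_nil]
    | cons i w =>
      rw [substS_cons, tailS_substS, substS_mulS, substS_cons, ← mulS_assoc]
      exact mulS_congr_right fun u hu => ih _ (by simp; omega) _ u rfl

lemma substS_injective {R R' A : NCS d} (hA : A [] = 1) (h : substS R A = substS R' A) :
    R = R' := by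
  funext w
  induction w generalizing R R' with
  | nil => rw [← substS_nil R A, h, substS_nil]
  | cons i w ih =>
    have ht : tailS (substS R A) i = tailS (substS R' A) i := by rw [h]
    rw [tailS_substS, tailS_substS] at ht
    exact ih (mulS_left_cancel hA ht)

/-- The solution `R` of `R(zA) = Y` when `A` has constant coefficient `1`. -/
def solveS (A : NCS d) : NCS d → List (Fin d) → ℂ
  | Y, [] => Y []
  | Y, i :: w => solveS A (mulS (invS A) (tailS Y i)) w

lemma substS_solveS {A : NCS d} (hA : A [] = 1) (Y : NCS d) : substS (solveS A Y) A = Y := by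
  funext w
  induction hn : w.length using Nat.strong_induction_on generalizing w Y with
  | _ n ih =>
    subst hn
    cases w with
    | nil => rw [substS_nil, solveS]
    | cons i w =>
      have ht : tailS (solveS A Y) i = solveS A (mulS (invS A) (tailS Y i)) := by
        funext u; rw [tailS, solveS]
      have hY : Y (i :: w) = mulS A (mulS (invS A) (tailS Y i)) w := by
        rw [← mulS_assoc, mulS_invS hA, oneS_mulS, tailS]
      rw [substS_cons, ht, hY]
      exact mulS_congr_right fun u hu => ih _ (by simp; omega) _ u rfl

end Substitution

section Transforms

variable {d : ℕ}

lemma HasR.substS_eq {m R : NCS d} (h : HasR m R) : substS R m = m - oneS d :=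
  funext h.2

lemma exists_hasR {m : NCS d} (hm : m [] = 1) : ∃ R, HasR m R :=
  ⟨solveS m (m - oneS d), by simp [solveS, hm, oneS],
    fun w => congrFun (substS_solveS hm (m - oneS d)) w⟩

lemma HasR.unique {m R R' : NCS d} (hm : m [] = 1) (h : HasR m R) (h' : HasR m R') : R = R' :=
  substS_injective hm (h.substS_eq.trans h'.substS_eq.symm)

lemma tailS_genS (β : Fin d → ℂ) (γ : ℂ) (m : NCS d) (i : Fin d) :
    tailS (genS β γ m) i = β i • oneS d + γ • mulS m (letterS i) := by
  funext w
  cases w with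
  | nil => simp [tailS, genS, oneS, mulS_nil, letterS]
  | cons j w => simp [tailS, genS, oneS, mulS_letterS]

lemma genS_mulS_eq_substS (β : Fin d → ℂ) (γ : ℂ) (m A : NCS d) :
    mulS (genS β γ (mulS A (substS m A))) A = substS (genS β γ m) A := by
  funext w
  cases w with
  | nil => simp [mulS_nil, substS_nil, genS]
  | cons i w =>
    have h : genS β γ (mulS A (substS m A)) [] = 0 := by rw [genS]
    rw [mulS_cons, substS_cons, tailS_genS, tailS_genS, h, zero_mul, zero_add]
    simp only [add_mulS, smul_mulS, oneS_mulS, substS_add, substS_smul, substS_oneS, substS_mulS,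
      substS_letterS, mulS_add, mulS_smul, mulS_oneS, mulS_assoc]

/-- If `R^{μ⊳ν}` is `Rs`, and `m` is the moment series with `R`-transform `t · Rs`, then the
series `m · (1 + M^ν)(zm)` has `R`-transform `R^ν + t · R^μ`. -/
lemma hasR_mulS_substS {mν m Rν Rμ Rs : NCS d} (t : ℂ) (hν : HasR mν Rν) (hμ : Rμ [] = 0)
    (hs : mulS Rs mν = substS Rμ mν) (hm : HasR m (t • Rs)) :
    HasR (mulS m (substS mν m)) (Rν + t • Rμ) := by
  refine ⟨by simp [hν.1, hμ], fun w => ?_⟩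
  have hm' : t • substS Rs m = m - oneS d := by rw [← substS_smul, hm.substS_eq]
  have hν' : substS mν m = substS (substS Rν mν) m + oneS d := by
    rw [← substS_oneS m, ← substS_add, hν.substS_eq, sub_add_cancel]
  have hsplit : mulS m (substS mν m) = t • mulS (substS Rs m) (substS mν m) + substS mν m := by
    rw [← smul_mulS, hm']
    nth_rw 3 [← oneS_mulS (substS mν m)]
    rw [← add_mulS, sub_add_cancel]
  have key : substS (Rν + t • Rμ) (mulS m (substS mν m)) = mulS m (substS mν m) - oneS d := by
    rw [substS_add, substS_smul, ← substS_substS, ← substS_substS, ← hs, substS_mulS, hsplit,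
      eq_sub_iff_add_eq, add_right_comm, ← hν', add_comm]
  exact congrFun key w

end Transforms

/-- Let `tβ ∈ ℝ^d`, `tγ > 0`, `tρ ∈ D_alg(d)` (moment series `mρ`), and
`{μ_t}` a free convolution semigroup in `D_alg(d)` (moment series `mμ t`, `R^{μ_t} = t·R1`).
Define the two-state semigroup `{(tμ_t, μ_t)}` by
`R^{tμ_t,μ_t}(z) = t·tβ·z + t·tγ·Σᵢ zᵢ(1+M^{tρ})zᵢ` (encoded via
`η^{tμ_t}·(1+M^{μ_t}) = R^{tμ_t,μ_t}(z(1+M^{μ_t}))` and `(1+M^{tμ_t})·η^{tμ_t} = M^{tμ_t}`),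
and let `τ` be the functional with `μ_1 = τ ⊳ tρ`. Then for every `t ≥ 0`,
`tμ_t = δ_{t·tβ} ⊎ Φ[tρ ⊞ τ^{⊞t}]^{⊎ tγ·t}`, i.e.
`η^{tμ_t}(z) = t·tβ·z + t·tγ·Σᵢ zᵢ(1+M^{tρ ⊞ τ^{⊞t}})zᵢ`. -/
theorem stmt18
    (d : ℕ) (tβ : Fin d → ℝ) (tγ : ℝ) (htγ : 0 < tγ)
    (mρ : NCS d) (hρ : mρ [] = 1)
    (mμ : ℝ → NCS d) (hμmom : ∀ t : ℝ, 0 ≤ t → mμ t [] = 1)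
    (R1 : NCS d) (hR1 : HasR (mμ 1) R1)
    (hsemi : ∀ t : ℝ, 0 ≤ t → HasR (mμ t) (fun w => (t : ℂ) * R1 w))
    (mtμ : ℝ → NCS d) (htμmom : ∀ t : ℝ, 0 ≤ t → mtμ t [] = 1)
    (htwostate : ∀ t : ℝ, 0 ≤ t → ∃ η : NCS d,
      (∀ w, mulS (mtμ t) η w = mtμ t w - oneS d w) ∧
      (∀ w, mulS η (mμ t) w =
        substS (fun v => (t : ℂ) * genS (fun i => (tβ i : ℂ)) (tγ : ℂ) mρ v) (mμ t) w))
    (mτ : NCS d) (hτmom : mτ [] = 1) (hτ : IsSubordS mτ mρ (mμ 1)) :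
    ∀ t : ℝ, 0 ≤ t → ∃ mconv : NCS d, mconv [] = 1 ∧
      (∃ Rρ Rτ : NCS d, HasR mρ Rρ ∧ HasR mτ Rτ ∧
        HasR mconv (fun w => Rρ w + (t : ℂ) * Rτ w)) ∧
      (∀ w, mulS (mtμ t)
          (fun v => (t : ℂ) * genS (fun i => (tβ i : ℂ)) (tγ : ℂ) mconv v) w =
        mtμ t w - oneS d w) := by
  intro t ht
  obtain ⟨Rτ, Rs, hRτ, hRs, hsub⟩ := hτ
  obtain ⟨Rρ, hRρ⟩ := exists_hasR hρ
  have hm1 : mμ t [] = 1 := hμmom t ht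
  have hRs1 : Rs = R1 := hRs.unique (hμmom 1 zero_le_one) hR1
  subst hRs1
  refine ⟨mulS (mμ t) (substS mρ (mμ t)), by simp [mulS_nil, substS_nil, hm1, hρ],
    ⟨Rρ, Rτ, hRρ, hRτ, hasR_mulS_substS t hRρ hRτ.1 (funext hsub) (hsemi t ht)⟩, ?_⟩
  obtain ⟨η, hη, hηm⟩ := htwostate t ht
  have hgen : mulS η (mμ t) = mulS ((t : ℂ) • genS (fun i => (tβ i : ℂ)) (tγ : ℂ)
      (mulS (mμ t) (substS mρ (mμ t)))) (mμ t) := by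
    rw [smul_mulS, genS_mulS_eq_substS, ← substS_smul]
    exact funext hηm
  rw [mulS_right_cancel hm1 hgen] at hη
  exact hη
end
end
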